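/- Let n > 2 be a natural number. Then the following are equivalent: (i) n is odd; (ii) for Lebesgue-almost every v ∈ ℂ^n, the family of 2n vectors {T^a v : a ∈ ℤ_n} ∪ {T^a D v : a ∈ ℤ_n} is a full spark frame (every subfamily of n of these vectors is linearly independent). -/

import Mathlib

/-- The `n × n` cyclic shift matrix `T`, acting by `(T v) j = v ((j - 1) mod n)`. -/
def shiftMat (n : ℕ) : Matrix (Fin n) (Fin n) ℂ :=
  Matrix.of fun j k => if ((k : ℕ) + 1) % n = (j : ℕ) then 1 else 0

/-- The `n × n` reversal matrix `D`, acting by `(D v) j = v ((n - j) mod n)`. -/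
def revMat (n : ℕ) : Matrix (Fin n) (Fin n) ℂ :=
  Matrix.of fun j k => if ((j : ℕ) + (k : ℕ)) % n = 0 then 1 else 0

/-- The family of `2n` vectors `{T^a v} ∪ {T^a D v}`, the `D₂ₙ`-orbit of `v`. -/
noncomputable def dihedralOrbit (n : ℕ) (v : Fin n → ℂ) :
    Fin 2 × Fin n → Fin n → ℂ :=
  fun p => ((shiftMat n) ^ (p.2 : ℕ)).mulVec (if p.1 = 0 then v else (revMat n).mulVec v)

/-- A family of `2n` vectors in `ℂⁿ` is a full spark frame (has the Haar property)
if every subfamily of `n` of the vectors is linearly independent. -/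
def IsFullSpark (n : ℕ) (f : Fin 2 × Fin n → Fin n → ℂ) : Prop :=
  ∀ S : Finset (Fin 2 × Fin n), S.card = n →
    LinearIndependent ℂ (fun i : {x // x ∈ S} => f i.1)

open MeasureTheory

lemma shiftMat_mulVec {n : ℕ} [NeZero n] (v : Fin n → ℂ) (j : Fin n) :
    (shiftMat n).mulVec v j = v (j - 1) := by
  have h : ∀ k : Fin n, ((k : ℕ) + 1) % n = (j : ℕ) ↔ k = j - 1 := by
    intro k
    rw [eq_sub_iff_add_eq, Fin.ext_iff, Fin.val_add, Fin.val_one', Nat.add_mod_mod]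
  simp [Matrix.mulVec, dotProduct, shiftMat, h]

lemma revMat_mulVec {n : ℕ} [NeZero n] (v : Fin n → ℂ) (j : Fin n) :
    (revMat n).mulVec v j = v (-j) := by
  have h : ∀ k : Fin n, ((j : ℕ) + (k : ℕ)) % n = 0 ↔ k = -j := by
    intro k
    rw [eq_neg_iff_add_eq_zero, add_comm k, Fin.ext_iff, Fin.val_add, Fin.val_zero]
  simp [Matrix.mulVec, dotProduct, revMat, h]

lemma shiftMat_pow_mulVec {n : ℕ} [NeZero n] (a : ℕ) (v : Fin n → ℂ) (j : Fin n) :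
    ((shiftMat n) ^ a).mulVec v j = v (j - (Fin.ofNat n a)) := by
  induction a generalizing j with
  | zero => simp
  | succ a ih =>
    rw [pow_succ', ← Matrix.mulVec_mulVec, shiftMat_mulVec, ih]
    congr 1
    rw [sub_sub]
    congr 1
    apply Fin.ext
    simp [Fin.val_add, add_comm]

lemma dihedralOrbit_zero {n : ℕ} [NeZero n] (v : Fin n → ℂ) (a j : Fin n) :
    dihedralOrbit n v (0, a) j = v (j - a) := by
  simp [dihedralOrbit, shiftMat_pow_mulVec]

lemma dihedralOrbit_one {n : ℕ} [NeZero n] (v : Fin n → ℂ) (b j : Fin n) :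
    dihedralOrbit n v (1, b) j = v (b - j) := by
  simp [dihedralOrbit, shiftMat_pow_mulVec, revMat_mulVec]

/-- If the determinant of a linear family of matrices is nonzero somewhere, it is nonzero
almost everywhere. -/
lemma ae_det_ne_zero {m n : ℕ} (M : (Fin m → ℂ) →ₗ[ℂ] Matrix (Fin n) (Fin n) ℂ)
    (v₀ : Fin m → ℂ) (h₀ : (M v₀).det ≠ 0) :
    ∀ᵐ v ∂(volume : Measure (Fin m → ℂ)), (M v).det ≠ 0 := by
  have hcont : Continuous fun v => (M v).det :=
    (LinearMap.continuous_of_finiteDimensional M).matrix_det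
  have hs : MeasurableSet {v | (M v).det ≠ 0} :=
    (isOpen_ne_fun hcont continuous_const).measurableSet
  refine ae_mem_of_ae_add_linearMap_mem (LinearMap.toSpanSingleton ℂ (Fin m → ℂ) v₀)
    (volume : Measure ℂ) volume hs fun y => ?_
  let p : Polynomial ℂ := Matrix.det
    ((Polynomial.X : Polynomial ℂ) • (M v₀).map Polynomial.C + (M y).map Polynomial.C)
  have hp : p ≠ 0 := by
    intro h
    have := Polynomial.coeff_det_X_add_C_card (M v₀) (M y)
    rw [show Matrix.det _ = p from rfl, h, Polynomial.coeff_zero] at this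
    exact h₀ this.symm
  have heval : ∀ x : ℂ, p.eval x = (M (y + x • v₀)).det := by
    intro x
    rw [← Polynomial.coe_evalRingHom, RingHom.map_det]
    congr 1
    ext i j
    simp [add_comm, mul_comm x]
  refine measure_mono_null (t := (p.roots.toFinset : Set ℂ)) ?_
    (Finset.measure_zero _ _)
  intro x hx
  have hx : (M (y + x • v₀)).det = 0 := not_not.1 hx
  rw [← heval] at hx
  simpa [hp] using hx

/-- Generalized Vandermonde independence, with consecutive exponents starting at `s`. -/
lemma eq_zero_of_sum_mul_pow_eq_zero {ι : Type*} (A : Finset ι) (f c : ι → ℂ)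
    (hf : Function.Injective f) (hf0 : ∀ i, f i ≠ 0) (s : ℕ)
    (h : ∀ k, s ≤ k → k < s + A.card → ∑ a ∈ A, c a * f a ^ k = 0) :
    ∀ a ∈ A, c a = 0 := by
  intro a ha
  let e := A.equivFin
  have key := Matrix.eq_zero_of_forall_pow_sum_mul_pow_eq_zero
    (f := fun i => f (e.symm i)) (v := fun i => c (e.symm i) * f (e.symm i) ^ s)
    (hf.comp (Subtype.val_injective.comp e.symm.injective)) (fun i => by
      rw [← h (s + i) (by omega) (by omega), ← Finset.sum_coe_sort A,
        ← e.symm.sum_comp]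
      exact Finset.sum_congr rfl fun j _ => by ring)
  have := congrFun key (e ⟨a, ha⟩)
  simpa [hf0] using this

lemma eq_zero_of_complementary_vanishing {ι : Type*} {n : ℕ} (A B : Finset ι) (f c d : ι → ℂ)
    (hf : Function.Injective f) (hf0 : ∀ i, f i ≠ 0) (hcard : A.card + B.card = n)
    (hA : ∀ k, 1 ≤ k → k ≤ A.card → ∑ a ∈ A, c a * f a ^ k = 0)
    (hB : (∀ k, ∑ a ∈ A, c a * f a ^ k = 0) →
      ∀ k, A.card < k → k ≤ n → ∑ b ∈ B, d b * f b ^ k = 0) :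
    (∀ a ∈ A, c a = 0) ∧ ∀ b ∈ B, d b = 0 := by
  have hc := eq_zero_of_sum_mul_pow_eq_zero A f c hf hf0 1 fun k h1 h2 => hA k h1 (by omega)
  refine ⟨hc, eq_zero_of_sum_mul_pow_eq_zero B f d hf hf0 (A.card + 1) fun k h1 h2 =>
    hB (fun k => Finset.sum_eq_zero fun a ha => by rw [hc a ha, zero_mul]) k (by omega) (by omega)⟩

lemma exists_fin_character (n : ℕ) [NeZero n] :
    ∃ e : Fin n → ℂ, Function.Injective e ∧ (∀ j, e j ≠ 0) ∧ (∀ j, e j ^ n = 1) ∧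
      ∀ i j, e (i - j) = e i * (e j)⁻¹ := by
  have hζ := Complex.isPrimitiveRoot_exp n (NeZero.ne n)
  set ζ := Complex.exp (2 * Real.pi * Complex.I / n)
  have h0 : ζ ≠ 0 := hζ.ne_zero (NeZero.ne n)
  have hadd : ∀ i j : Fin n, ζ ^ (i + j : Fin n).val = ζ ^ i.val * ζ ^ j.val := by
    intro i j
    rw [← pow_add, Fin.val_add, ← pow_eq_pow_mod _ hζ.pow_eq_one]
  refine ⟨fun j => ζ ^ j.val, fun i j h => Fin.ext (hζ.pow_inj i.2 j.2 h),
    fun j => pow_ne_zero _ h0, fun j => ?_, fun i j => ?_⟩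
  · rw [← pow_mul, mul_comm, pow_mul, hζ.pow_eq_one, one_pow]
  · rw [eq_mul_inv_iff_mul_eq₀ (pow_ne_zero _ h0), ← hadd, sub_add_cancel]

lemma pow_val_neg {n : ℕ} [NeZero n] {z : ℂ} (hz : z ^ n = 1) (k : Fin n) :
    z ^ (-k : Fin n).val = z⁻¹ ^ k.val := by
  have hz0 : z ≠ 0 := by
    rintro rfl
    simp [NeZero.ne n] at hz
  rw [inv_pow, ← mul_eq_one_iff_eq_inv₀ (pow_ne_zero _ hz0), ← pow_add]
  have h : n ∣ (-k : Fin n).val + k.val := by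
    apply Nat.dvd_of_mod_eq_zero
    rw [← Fin.val_add, neg_add_cancel, Fin.val_zero]
  obtain ⟨q, hq⟩ := h
  rw [hq, pow_mul, hz, one_pow]

lemma sum_mem_fin_two_prod {n : ℕ} {M : Type*} [AddCommMonoid M] (S : Finset (Fin 2 × Fin n))
    (F : Fin 2 × Fin n → M) :
    ∑ p ∈ S, F p = ∑ a with (0, a) ∈ S, F (0, a) + ∑ b with (1, b) ∈ S, F (1, b) := by
  rw [← Finset.sum_ite_mem_eq S, Fintype.sum_prod_type, Fin.sum_univ_two, Finset.sum_filter,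
    Finset.sum_filter]

/-- The Fourier-side form of a linear relation between vectors of the orbit of `v`, where `x` is
the sequence of Fourier coefficients of `v`. -/
lemma fourier_relation {n : ℕ} [NeZero n] (e : Fin n → ℂ) (hinj : Function.Injective e)
    (h1 : ∀ j, e j ^ n = 1) (hsub : ∀ i j, e (i - j) = e i * (e j)⁻¹)
    (A B : Finset (Fin n)) (c d x : Fin n → ℂ)
    (h : ∀ j, ∑ a ∈ A, c a * ∑ k, x k * e (j - a) ^ k.val +
      ∑ b ∈ B, d b * ∑ k, x k * e (b - j) ^ k.val = 0) (k : Fin n) :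
    x k * ∑ a ∈ A, c a * (e a)⁻¹ ^ k.val + x (-k) * ∑ b ∈ B, d b * (e b)⁻¹ ^ k.val = 0 := by
  refine congrFun (Matrix.eq_zero_of_forall_index_sum_mul_pow_eq_zero
    (v := fun k : Fin n => x k * ∑ a ∈ A, c a * (e a)⁻¹ ^ k.val +
      x (-k) * ∑ b ∈ B, d b * (e b)⁻¹ ^ k.val) hinj fun j => ?_) k
  rw [← h j]
  have hB : ∀ b, ∑ k, x k * e (b - j) ^ k.val =
      ∑ k, x (-k) * ((e b)⁻¹ ^ k.val * e j ^ k.val) := by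
    intro b
    rw [← Equiv.sum_comp (Equiv.neg (Fin n))]
    refine Finset.sum_congr rfl fun k _ => ?_
    rw [Equiv.neg_apply, pow_val_neg (h1 _), hsub, mul_inv, inv_inv, mul_pow]
  simp_rw [hB, hsub, add_mul, Finset.sum_add_distrib, Finset.mul_sum, Finset.sum_mul]
  rw [Finset.sum_comm (s := A), Finset.sum_comm (s := B)]
  congr 1 <;> refine Finset.sum_congr rfl fun k _ => Finset.sum_congr rfl fun a _ => by ring

lemma val_neg_of_ne_zero {n : ℕ} [NeZero n] (k : Fin n) (hk : 0 < k.val) :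
    (-k : Fin n).val = n - k.val := by
  rw [Fin.val_neg', Nat.mod_eq_of_lt (by omega)]

lemma exists_linearIndepOn_dihedralOrbit {n : ℕ} [NeZero n] (hn : Odd n)
    (S : Finset (Fin 2 × Fin n)) (hS : S.card = n) :
    ∃ v, LinearIndepOn ℂ (dihedralOrbit n v) (S : Set (Fin 2 × Fin n)) := by
  obtain ⟨e, hinj, h0, h1, hsub⟩ := exists_fin_character n
  set A : Finset (Fin n) := {a | (0, a) ∈ S} with hA
  set B : Finset (Fin n) := {b | (1, b) ∈ S} with hB
  have hcard : A.card + B.card = n := by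
    refine Eq.trans ?_ hS
    rw [Finset.card_eq_sum_ones S, sum_mem_fin_two_prod]
    simp [hA, hB]
  suffices ∃ x : Fin n → ℂ, ∀ c d : Fin n → ℂ,
      (∀ k : Fin n, x k * ∑ a ∈ A, c a * (e a)⁻¹ ^ k.val +
        x (-k) * ∑ b ∈ B, d b * (e b)⁻¹ ^ k.val = 0) →
      (∀ a ∈ A, c a = 0) ∧ ∀ b ∈ B, d b = 0 by
    obtain ⟨x, hx⟩ := this
    refine ⟨fun j => ∑ k, x k * e j ^ k.val, linearIndepOn_finset_iff.2 fun g hg => ?_⟩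
    obtain ⟨hc, hd⟩ := hx (fun a => g (0, a)) (fun b => g (1, b))
      (fourier_relation e hinj h1 hsub A B _ _ x fun j => by
        have := congrFun hg j
        rw [sum_mem_fin_two_prod] at this
        simpa [dihedralOrbit_zero, dihedralOrbit_one] using this)
    rintro ⟨i, a⟩ hi
    fin_cases i
    · exact hc a (by simpa [hA] using hi)
    · exact hd a (by simpa [hB] using hi)
  have hinj' : Function.Injective fun a => (e a)⁻¹ := inv_injective.comp hinj
  have h0' : ∀ a, (e a)⁻¹ ≠ 0 := fun a => inv_ne_zero (h0 a)
  have hper : ∀ (E : Finset (Fin n)) (c : Fin n → ℂ),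
      ∑ a ∈ E, c a * (e a)⁻¹ ^ n = ∑ a ∈ E, c a * (e a)⁻¹ ^ 0 := fun E c => by
    simp [h1]
  have hneg : ∀ (k : ℕ) (hk : k < n), 0 < k → (-⟨k, hk⟩ : Fin n).val = n - k :=
    fun k hk h => val_neg_of_ne_zero ⟨k, hk⟩ h
  rcases hn with ⟨m, hm⟩
  rcases le_or_gt A.card m with hle | hle
  · refine ⟨fun k => if n - A.card ≤ k.val then 0 else 1, fun c d hrel => ?_⟩
    beta_reduce at hrel
    refine eq_zero_of_complementary_vanishing A B (fun a => (e a)⁻¹) c d hinj' h0' hcard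
      (fun k hk1 hk2 => ?_) (fun hP k hk1 hk2 => ?_)
    · have := hrel ⟨k, by omega⟩
      rwa [hneg _ _ hk1, if_neg (by dsimp only; omega), if_pos (by omega), one_mul, zero_mul,
        add_zero] at this
    · rcases hk2.eq_or_lt with h | hlt
      · have := hrel 0
        rw [neg_zero, Fin.val_zero, hP, if_neg (by omega), mul_zero, zero_add, one_mul] at this
        rwa [h, hper]
      · have := hrel ⟨k, hlt⟩
        rwa [hP, hneg _ _ (by omega), if_neg (c := n - A.card ≤ n - k) (by omega), mul_zero,
          zero_add, one_mul] at this
  · refine ⟨fun k => if 1 ≤ k.val ∧ k.val ≤ B.card then 0 else 1, fun c d hrel => ?_⟩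
    beta_reduce at hrel
    refine (eq_zero_of_complementary_vanishing B A (fun a => (e a)⁻¹) d c hinj' h0'
      ((add_comm _ _).trans hcard) (fun k hk1 hk2 => ?_) (fun hQ k hk1 hk2 => ?_)).symm
    · have := hrel ⟨k, by omega⟩
      rwa [hneg _ _ hk1, if_pos (by dsimp only; omega), if_neg (by omega), one_mul, zero_mul,
        zero_add] at this
    · rcases hk2.eq_or_lt with h | hlt
      · have := hrel 0
        rw [Fin.val_zero, hQ, if_neg (by omega), mul_zero, add_zero, one_mul] at this
        rwa [h, hper]
      · have := hrel ⟨k, hlt⟩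
        rwa [hQ, if_neg (by dsimp only; omega), mul_zero, add_zero, one_mul] at this

lemma ae_linearIndepOn_dihedralOrbit {n : ℕ} [NeZero n] (hn : Odd n)
    (S : Finset (Fin 2 × Fin n)) (hS : S.card = n) :
    ∀ᵐ v ∂(volume : Measure (Fin n → ℂ)),
      LinearIndependent ℂ (fun i : {x // x ∈ S} => dihedralOrbit n v i.1) := by
  let e : {x // x ∈ S} ≃ Fin n := S.equivFinOfCardEq hS
  let M : (Fin n → ℂ) →ₗ[ℂ] Matrix (Fin n) (Fin n) ℂ :=
    { toFun := fun v => Matrix.of fun i => dihedralOrbit n v (e.symm i).1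
      map_add' := fun v w => by
        ext i j
        simp only [dihedralOrbit, Matrix.of_apply, Matrix.add_apply]
        split_ifs <;> simp [Matrix.mulVec_add]
      map_smul' := fun c v => by
        ext i j
        simp only [dihedralOrbit, Matrix.of_apply, Matrix.smul_apply]
        split_ifs <;> simp [Matrix.mulVec_smul] }
  have hM : ∀ v, LinearIndependent ℂ (fun i : {x // x ∈ S} => dihedralOrbit n v i.1) ↔
      (M v).det ≠ 0 := by
    intro v
    rw [← isUnit_iff_ne_zero, ← Matrix.isUnit_iff_isUnit_det,
      ← Matrix.linearIndependent_rows_iff_isUnit, ← linearIndependent_equiv e.symm]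
    rfl
  obtain ⟨v₀, hv₀⟩ := exists_linearIndepOn_dihedralOrbit hn S hS
  simp_rw [hM]
  exact ae_det_ne_zero M v₀ ((hM v₀).1 hv₀)

lemma even_val_sub {n : ℕ} (hn : Even n) (j a : Fin n) :
    Even (j + j - a : Fin n).val ↔ Even a.val := by
  have h : ∀ k, Even (k % n) ↔ Even k := fun k => by
    rw [Nat.even_iff, Nat.even_iff, Nat.mod_mod_of_dvd _ hn.two_dvd]
  rw [Fin.val_sub, h, Fin.val_add, Nat.even_add, h, Nat.even_sub a.2.le]
  simp [hn]

lemma card_even_fin {n : ℕ} (hn : Even n) :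
    2 * (Finset.univ.filter fun a : Fin n => Even a.val).card = n := by
  obtain ⟨m, rfl⟩ := hn
  rw [Finset.card_filter, Fin.sum_univ_eq_sum_range (fun i => if Even i then 1 else 0)]
  induction m with
  | zero => simp
  | succ m ih =>
    rw [show m + 1 + (m + 1) = m + m + 1 + 1 by ring, Finset.sum_range_succ,
      Finset.sum_range_succ, mul_add, mul_add, ih]
    simp [Nat.even_add_one]

/-- For even `n`, the even translates of `v` and of its reversal have the same sum. -/
lemma not_isFullSpark_of_even {n : ℕ} [NeZero n] (hn : Even n) (v : Fin n → ℂ) :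
    ¬ IsFullSpark n (dihedralOrbit n v) := by
  intro h
  let E : Finset (Fin n) := {a | Even a.val}
  have hind := h (Finset.univ ×ˢ E) (by
    rw [Finset.card_product, Finset.card_univ, Fintype.card_fin, card_even_fin hn])
  have hind : LinearIndepOn ℂ (dihedralOrbit n v)
    ((Finset.univ ×ˢ E : Finset (Fin 2 × Fin n)) : Set (Fin 2 × Fin n)) := hind
  rw [linearIndepOn_finset_iff] at hind
  have := hind (fun p => if p.1 = 0 then 1 else -1) (by
    ext j
    rw [Finset.sum_product]
    simp only [Fin.sum_univ_two, Finset.sum_apply, if_true, one_smul, one_ne_zero, if_false,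
      neg_smul, Pi.neg_apply,
      dihedralOrbit_zero, dihedralOrbit_one, Pi.zero_apply, Finset.sum_neg_distrib]
    rw [add_neg_eq_zero]
    refine Finset.sum_nbij' (fun a => j + j - a) (fun a => j + j - a) ?_ ?_ ?_ ?_ ?_
    · intro a ha
      simpa [E, even_val_sub hn] using ha
    · intro a ha
      simpa [E, even_val_sub hn] using ha
    · intro a _
      abel
    · intro a _
      abel
    · intro a _
      congr 1
      abel) (0, 0) (by simp [E])
  simp at this

theorem ae_dihedral_orbit_full_spark_iff_odd
    (n : ℕ) (hn : 2 < n) :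
    Odd n ↔
      (∀ᵐ v ∂(volume : Measure (Fin n → ℂ)), IsFullSpark n (dihedralOrbit n v)) := by
  have : NeZero n := ⟨by omega⟩
  constructor
  · intro hodd
    simp only [IsFullSpark]
    rw [ae_all_iff]
    intro S
    by_cases hS : S.card = n
    · simpa [hS] using ae_linearIndepOn_dihedralOrbit hodd S hS
    · simp [hS]
  · intro h
    by_contra hodd
    obtain ⟨v, hv⟩ := h.exists
    exact not_isFullSpark_of_even (Nat.not_odd_iff_even.1 hodd) v hv
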